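/- arXiv:2401.01015 — 4 statements merged into one kernel-verified Lean document; each statement's English description precedes it below -/
import Mathlib

section
/- Let M be a sober MT-algebra and F a Scott-open filter of M. Then for every open element u ∈ O(M), if ⋀F ≤ u then u ∈ F. -/
/-- An MT-algebra: a complete Boolean algebra with an interior operator. -/
structure MTAlg (M : Type*) [CompleteBooleanAlgebra M] where
  box : M → M
  box_top : box ⊤ = ⊤
  box_inf : ∀ a b : M, box (a ⊓ b) = box a ⊓ box b
  box_le : ∀ a : M, box a ≤ a
  box_idem : ∀ a : M, box a ≤ box (box a)

namespace MTAlg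

variable {M : Type*} [CompleteBooleanAlgebra M] (T : MTAlg M)

/-- The closure (dual) operator. -/
def dia (a : M) : M := (T.box aᶜ)ᶜ

/-- Open elements. -/
def IsOpenElem (a : M) : Prop := T.box a = a

/-- Closed elements. -/
def IsClosedElem (a : M) : Prop := T.dia a = a

/-- Saturated elements: meets of open elements. -/
def IsSaturatedElem (a : M) : Prop :=
  ∃ S : Set M, (∀ s ∈ S, T.IsOpenElem s) ∧ a = sInf S

/-- Weakly locally closed elements: meets of a saturated and a closed element. -/
def IsWLC (a : M) : Prop :=
  ∃ s c : M, T.IsSaturatedElem s ∧ T.IsClosedElem c ∧ a = s ⊓ c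

/-- T0-algebras: every element is a join of weakly locally closed elements. -/
def IsT0 : Prop :=
  ∀ a : M, ∃ S : Set M, (∀ b ∈ S, T.IsWLC b) ∧ a = sSup S

/-- T1-algebras: every element is a join of closed elements. -/
def IsT1 : Prop :=
  ∀ a : M, ∃ S : Set M, (∀ b ∈ S, T.IsClosedElem b) ∧ a = sSup S

/-- Join-irreducible elements of the lattice of closed elements. -/
def JoinIrredClosed (p : M) : Prop :=
  T.IsClosedElem p ∧ p ≠ ⊥ ∧
    ∀ a b : M, T.IsClosedElem a → T.IsClosedElem b → p = a ⊔ b → p = a ∨ p = b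

/-- Sober MT-algebras. -/
def Sober : Prop :=
  T.IsT0 ∧ ∀ p : M, T.JoinIrredClosed p → ∃ x : M, IsAtom x ∧ p = T.dia x

/-- Filters of the underlying lattice. -/
def IsFilter (F : Set M) : Prop :=
  ⊤ ∈ F ∧ (∀ a b : M, a ∈ F → a ≤ b → b ∈ F) ∧ (∀ a b : M, a ∈ F → b ∈ F → a ⊓ b ∈ F)

/-- Open filters. -/
def IsOpenFilter (F : Set M) : Prop :=
  IsFilter F ∧ ∀ a ∈ F, T.box a ∈ F

/-- Scott-open filters. -/
def IsScottOpenFilter (F : Set M) : Prop :=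
  T.IsOpenFilter F ∧
    ∀ S : Set M, (∀ s ∈ S, T.IsOpenElem s) → S.Nonempty → DirectedOn (· ≤ ·) S →
      sSup S ∈ F → ∃ s ∈ S, s ∈ F

/-- Compact elements. -/
def IsCompactElem (a : M) : Prop :=
  ∀ S : Set M, (∀ s ∈ S, T.IsOpenElem s) → a ≤ sSup S →
    ∃ t ⊆ S, t.Finite ∧ a ≤ sSup t

/-- The relation `a ◁ b`: there is a compact element between `a` and `b`. -/
def Triangle (a b : M) : Prop := ∃ k : M, T.IsCompactElem k ∧ a ≤ k ∧ k ≤ b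

/-- Locally compact MT-algebras. -/
def LocallyCompact : Prop :=
  ∀ u : M, T.IsOpenElem u → u = sSup {v : M | T.IsOpenElem v ∧ T.Triangle v u}

/-- The way-below relation in the frame of open elements. -/
def WayBelowOpen (a b : M) : Prop :=
  ∀ S : Set M, (∀ s ∈ S, T.IsOpenElem s) → b ≤ sSup S →
    ∃ t ⊆ S, t.Finite ∧ a ≤ sSup t

/-- Elements approximated from above by regular closed elements. -/
def GC (a : M) : Prop :=
  a = sInf {b : M | ∃ c : M, a ≤ T.box c ∧ b = T.dia (T.box c)}

/-- Hausdorff MT-algebras. -/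
def IsHausdorff : Prop :=
  ∀ a : M, ∃ S : Set M, (∀ b ∈ S, T.GC b) ∧ a = sSup S

/-- Regular MT-algebras. -/
def IsRegular : Prop :=
  T.IsT1 ∧ ∀ a : M, T.IsOpenElem a →
    a = sSup {b : M | T.IsOpenElem b ∧ T.dia b ≤ a}

end MTAlg

/-- The atom space of a complete Boolean algebra. -/
abbrev AtomSpace (M : Type*) [CompleteBooleanAlgebra M] : Type _ := {x : M // IsAtom x}

/-- The set of atoms below an element. -/
def eta {M : Type*} [CompleteBooleanAlgebra M] (a : M) : Set (AtomSpace M) :=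
  {x : AtomSpace M | x.1 ≤ a}

namespace MTAlg

variable {M : Type*} [CompleteBooleanAlgebra M] (T : MTAlg M)

/-- The topology on the atom space, generated by the images of open elements. -/
def atTop : TopologicalSpace (AtomSpace M) :=
  TopologicalSpace.generateFrom {U : Set (AtomSpace M) | ∃ u : M, T.IsOpenElem u ∧ U = eta u}

end MTAlg

namespace MTAlg

variable {M : Type*} [CompleteBooleanAlgebra M] (T : MTAlg M)

theorem box_mono {a b : M} (h : a ≤ b) : T.box a ≤ T.box b := by
  rw [← inf_eq_left, ← T.box_inf, inf_eq_left.mpr h]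

theorem isOpenElem_box (a : M) : T.IsOpenElem (T.box a) :=
  le_antisymm (T.box_le _) (T.box_idem a)

variable {T}

theorem IsOpenElem.le_box {a b : M} (ha : T.IsOpenElem a) (h : a ≤ b) : a ≤ T.box b :=
  ha.ge.trans (T.box_mono h)

theorem isOpenElem_sSup {S : Set M} (hS : ∀ s ∈ S, T.IsOpenElem s) : T.IsOpenElem (sSup S) :=
  le_antisymm (T.box_le _) (sSup_le fun s hs => (hS s hs).le_box (le_sSup hs))

theorem IsOpenElem.compl {a : M} (ha : T.IsOpenElem a) : T.IsClosedElem aᶜ := by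
  unfold IsClosedElem dia
  rw [compl_compl, ha]

theorem IsClosedElem.compl {a : M} (ha : T.IsClosedElem a) : T.IsOpenElem aᶜ :=
  compl_injective (ha.trans (compl_compl a).symm)

theorem le_dia (a : M) : a ≤ T.dia a :=
  le_compl_comm.mp (T.box_le _)

theorem IsOpenElem.dia_le_compl {a b : M} (ha : T.IsOpenElem a) (h : b ≤ aᶜ) : T.dia b ≤ aᶜ :=
  compl_le_compl (ha.le_box (le_compl_comm.mp h))

/-- An open element outside a Scott-open filter lies below a maximal such element. -/
theorem IsScottOpenFilter.exists_maximal_notMem {F : Set M} (hF : T.IsScottOpenFilter F) {u : M}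
    (hu : T.IsOpenElem u) (huF : u ∉ F) :
    ∃ v, u ≤ v ∧ Maximal (fun w => T.IsOpenElem w ∧ w ∉ F) v := by
  refine zorn_le_nonempty₀ {w | T.IsOpenElem w ∧ w ∉ F} (fun c hc hchain y hy => ?_) u ⟨hu, huF⟩
  refine ⟨sSup c, ⟨isOpenElem_sSup fun s hs => (hc hs).1, fun hmem => ?_⟩, fun z => le_sSup⟩
  obtain ⟨s, hs, hsF⟩ := hF.2 c (fun s hs => (hc hs).1) ⟨y, hy⟩ hchain.directedOn hmem
  exact (hc hs).2 hsF

/-- The complement of an open element maximal outside a filter is join-irreducible. -/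
theorem joinIrredClosed_compl_of_maximal {F : Set M} (hF : IsFilter F) {v : M}
    (hv : Maximal (fun w => T.IsOpenElem w ∧ w ∉ F) v) : T.JoinIrredClosed vᶜ := by
  obtain ⟨htop, -, hinf⟩ := hF
  refine ⟨hv.prop.1.compl, fun h => hv.prop.2 (compl_eq_bot.mp h ▸ htop), fun a b ha hb hab => ?_⟩
  have hvab : v = aᶜ ⊓ bᶜ := by rw [← compl_sup, ← hab, compl_compl]
  have key {c : M} (hc : T.IsClosedElem c) (hle : v ≤ cᶜ) (hne : vᶜ ≠ c) : cᶜ ∈ F := by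
    by_contra hcF
    exact hne (compl_eq_comm.mp (hv.eq_of_ge ⟨hc.compl, hcF⟩ hle))
  by_contra! hne
  exact hv.prop.2 (hvab ▸ hinf _ _ (key ha (hvab.trans_le inf_le_left) hne.1)
    (key hb (hvab.trans_le inf_le_right) hne.2))

end MTAlg

/-- Keimel–Paseka lemma for sober MT-algebras. -/
theorem keimel_paseka {M : Type*} [CompleteBooleanAlgebra M] (T : MTAlg M)
    (hsob : T.Sober) (F : Set M) (hF : T.IsScottOpenFilter F)
    (u : M) (hu : T.IsOpenElem u) (hle : sInf F ≤ u) : u ∈ F := by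
  by_contra huF
  obtain ⟨v, huv, hv⟩ := hF.exists_maximal_notMem hu huF
  obtain ⟨x, hx, hvx⟩ := hsob.2 _ (MTAlg.joinIrredClosed_compl_of_maximal hF.1.1 hv)
  have hxF : x ≤ sInf F := by
    refine le_sInf fun a ha => ?_
    have hbox := hF.1.2 a ha
    by_contra hxa
    have hdisj : x ≤ (T.box a)ᶜ := le_compl_iff_disjoint_right.mpr
      (hx.not_le_iff_disjoint.mp fun h => hxa (h.trans (T.box_le a)))
    have hav : T.box a ≤ v :=
      compl_le_compl_iff_le.mp (hvx.trans_le ((T.isOpenElem_box a).dia_le_compl hdisj))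
    exact hv.prop.2 (hF.1.1.2.1 _ _ hbox hav)
  exact hx.1 (le_bot_iff.mp ((le_inf (hxF.trans (hle.trans huv))
    ((MTAlg.le_dia x).trans hvx.ge)).trans inf_compl_eq_bot.le))
end

section
/- For every frame L, the map H ↦ ζ⁻¹[H] is an order-isomorphism from the poset of Scott-open filters of the frame Ω(pt(L)) of open sets of the point space of L, ordered by inclusion, onto the poset of Scott-open filters of L ordered by inclusion. -/
/-- A filter of a frame. -/
def FrameFilter {L : Type*} [Order.Frame L] (F : Set L) : Prop :=
  ⊤ ∈ F ∧ (∀ a b : L, a ∈ F → a ≤ b → b ∈ F) ∧ (∀ a b : L, a ∈ F → b ∈ F → a ⊓ b ∈ F)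

/-- A Scott-open filter of a frame. -/
def ScottOpenFrameFilter {L : Type*} [Order.Frame L] (F : Set L) : Prop :=
  FrameFilter F ∧
    ∀ S : Set L, S.Nonempty → DirectedOn (· ≤ ·) S → sSup S ∈ F → ∃ s ∈ S, s ∈ F

/-- A completely prime filter of a frame. -/
def CPFilter {L : Type*} [Order.Frame L] (p : Set L) : Prop :=
  FrameFilter p ∧ ∀ S : Set L, sSup S ∈ p → ∃ s ∈ S, s ∈ p

/-- The space of points (completely prime filters) of a frame. -/
abbrev PtSpace (L : Type*) [Order.Frame L] : Type _ := {p : Set L // CPFilter p}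

instance ptTopology (L : Type*) [Order.Frame L] : TopologicalSpace (PtSpace L) :=
  TopologicalSpace.generateFrom {U : Set (PtSpace L) | ∃ a : L, U = {p : PtSpace L | a ∈ p.1}}

/-- The basic open set of the point space associated with a frame element. -/
def zeta {L : Type*} [Order.Frame L] (a : L) : TopologicalSpace.Opens (PtSpace L) :=
  ⟨{p : PtSpace L | a ∈ p.1}, TopologicalSpace.isOpen_generateFrom_of_mem ⟨a, rfl⟩⟩

/-- Saturated subsets of a topological space: intersections of open sets. -/
def IsSaturatedSet {X : Type*} [TopologicalSpace X] (K : Set X) : Prop :=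
  ∃ U : Set (Set X), (∀ u ∈ U, IsOpen u) ∧ K = ⋂₀ U

section PointSpace

open TopologicalSpace

variable {L : Type*} [Order.Frame L]

theorem FrameFilter.inf_mem_iff {F : Set L} (hF : FrameFilter F) {a b : L} :
    a ⊓ b ∈ F ↔ a ∈ F ∧ b ∈ F :=
  ⟨fun h => ⟨hF.2.1 _ _ h inf_le_left, hF.2.1 _ _ h inf_le_right⟩, fun h => hF.2.2 _ _ h.1 h.2⟩

theorem CPFilter.sSup_mem_iff {p : Set L} (hp : CPFilter p) {S : Set L} :
    sSup S ∈ p ↔ ∃ s ∈ S, s ∈ p :=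
  ⟨hp.2 S, fun ⟨_, hs, hsp⟩ => hp.1.2.1 _ _ hsp (le_sSup hs)⟩

theorem mem_zeta {a : L} {p : PtSpace L} : p ∈ zeta a ↔ a ∈ p.1 := Iff.rfl

theorem zeta_mono : Monotone (zeta : L → Opens (PtSpace L)) :=
  fun _ _ hab p hp => p.2.1.2.1 _ _ hp hab

theorem zeta_top : zeta (⊤ : L) = ⊤ :=
  top_le_iff.1 fun p _ => p.2.1.1

theorem zeta_inf (a b : L) : zeta (a ⊓ b) = zeta a ⊓ zeta b := by
  ext p
  exact p.2.1.inf_mem_iff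

theorem zeta_sSup (S : Set L) : zeta (sSup S) = sSup (zeta '' S) := by
  ext p
  rw [SetLike.mem_coe, SetLike.mem_coe, mem_zeta, p.2.sSup_mem_iff, Opens.mem_sSup]
  simp only [Set.exists_mem_image, mem_zeta]

theorem zeta_surjective : Function.Surjective (zeta : L → Opens (PtSpace L)) := by
  rintro ⟨U, hU⟩
  suffices h : ∃ a : L, {p : PtSpace L | a ∈ p.1} = U from
    h.imp fun a ha => Opens.ext ha
  induction hU with
  | basic s hs => exact hs.imp fun a ha => ha.symm
  | univ => exact ⟨⊤, Set.eq_univ_of_forall fun p => p.2.1.1⟩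
  | inter s t _ _ ihs iht =>
    obtain ⟨a, rfl⟩ := ihs
    obtain ⟨b, rfl⟩ := iht
    exact ⟨a ⊓ b, Set.ext fun p => p.2.1.inf_mem_iff⟩
  | sUnion K _ ih =>
    refine ⟨sSup {a | {p : PtSpace L | a ∈ p.1} ∈ K}, Set.ext fun p => ?_⟩
    rw [Set.mem_ofPred_eq, p.2.sSup_mem_iff]
    constructor
    · rintro ⟨a, ha, hap⟩
      exact ⟨_, ha, hap⟩
    · rintro ⟨s, hs, hps⟩
      obtain ⟨a, rfl⟩ := ih s hs
      exact ⟨a, hs, hps⟩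

/-- The complement of the principal ideal of a prime element is completely prime. -/
theorem cpFilter_not_le {m : L} (hm : m ≠ ⊤) (hprime : ∀ x y, x ⊓ y ≤ m → x ≤ m ∨ y ≤ m) :
    CPFilter {x : L | ¬ x ≤ m} := by
  refine ⟨⟨fun h => hm (top_le_iff.1 h), fun a b ha hab hb => ha (hab.trans hb),
    fun a b ha hb hab => (hprime a b hab).elim ha hb⟩, fun S hS => ?_⟩
  by_contra! h
  exact hS (sSup_le fun s hs => not_not.1 (h s hs))

/-- An element outside a Scott-open filter lies below a maximal such element. -/
theorem ScottOpenFrameFilter.exists_le_maximal {F : Set L} (hF : ScottOpenFrameFilter F) {a : L}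
    (ha : a ∉ F) : ∃ m, a ≤ m ∧ Maximal (· ∉ F) m := by
  refine zorn_le_nonempty₀ Fᶜ (fun c hc hchain y hy => ⟨sSup c, fun h => ?_, fun z => le_sSup⟩)
    a ha
  obtain ⟨s, hs, hsF⟩ := hF.2 c ⟨y, hy⟩ hchain.directedOn h
  exact hc hs hsF

/-- Every Scott-open filter is the intersection of the completely prime filters containing it. -/
theorem ScottOpenFrameFilter.exists_cpFilter {F : Set L} (hF : ScottOpenFrameFilter F) {a : L}
    (ha : a ∉ F) : ∃ p : Set L, CPFilter p ∧ F ⊆ p ∧ a ∉ p := by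
  obtain ⟨m, ham, hm⟩ := hF.exists_le_maximal ha
  refine ⟨{x | ¬ x ≤ m}, cpFilter_not_le ?_ fun x y hxy => ?_,
    fun x hx hxm => hm.prop (hF.1.2.1 _ _ hx hxm), not_not.2 ham⟩
  · rintro rfl
    exact hm.prop hF.1.1
  · by_contra! h
    have sup_mem : ∀ z, ¬ z ≤ m → m ⊔ z ∈ F := fun z hz => by
      by_contra hzF
      exact hz (le_sup_right.trans (hm.le_of_ge hzF le_sup_left))
    have hinf := hF.1.2.2 _ _ (sup_mem x h.1) (sup_mem y h.2)
    rw [← sup_inf_left, sup_eq_left.2 hxy] at hinf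
    exact hm.prop hinf

theorem ScottOpenFrameFilter.mem_of_zeta_le {F : Set L} (hF : ScottOpenFrameFilter F) {a b : L}
    (ha : a ∈ F) (hab : zeta a ≤ zeta b) : b ∈ F := by
  by_contra hb
  obtain ⟨p, hp, hFp, hbp⟩ := hF.exists_cpFilter hb
  exact hbp (hab (show (⟨p, hp⟩ : PtSpace L) ∈ zeta a from hFp ha))

theorem ScottOpenFrameFilter.preimage_zeta {H : Set (Opens (PtSpace L))}
    (hH : ScottOpenFrameFilter H) : ScottOpenFrameFilter (zeta ⁻¹' H : Set L) := by
  refine ⟨⟨?_, fun a b ha hab => hH.1.2.1 _ _ ha (zeta_mono hab), fun a b ha hb => ?_⟩,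
    fun S hne hdir hS => ?_⟩
  · rw [Set.mem_preimage, zeta_top]
    exact hH.1.1
  · rw [Set.mem_preimage, zeta_inf]
    exact hH.1.2.2 _ _ ha hb
  · rw [Set.mem_preimage, zeta_sSup] at hS
    have hdir' : DirectedOn (· ≤ ·) (zeta '' S) := hdir.mono_comp fun _ _ h => zeta_mono h
    obtain ⟨_, ⟨s, hs, rfl⟩, hsH⟩ := hH.2 _ (hne.image zeta) hdir' hS
    exact ⟨s, hs, hsH⟩

/-- The largest element of the frame whose basic open set is contained in `U`. -/
def zetaAdjoint (U : Opens (PtSpace L)) : L := sSup {b | zeta b ≤ U}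

theorem zetaAdjoint_mono : Monotone (zetaAdjoint : Opens (PtSpace L) → L) :=
  fun _ _ hUV => sSup_le_sSup fun _ hb => le_trans hb hUV

theorem zeta_zetaAdjoint (U : Opens (PtSpace L)) : zeta (zetaAdjoint U) = U := by
  obtain ⟨a, rfl⟩ := zeta_surjective U
  refine le_antisymm ?_ (zeta_mono (le_sSup (le_refl (zeta a))))
  rw [zetaAdjoint, zeta_sSup]
  intro p hp
  obtain ⟨_, ⟨b, hb, rfl⟩, hpb⟩ := Opens.mem_sSup.1 hp
  exact hb hpb

theorem ScottOpenFrameFilter.preimage_zetaAdjoint {F : Set L} (hF : ScottOpenFrameFilter F) :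
    ScottOpenFrameFilter (zetaAdjoint ⁻¹' F) := by
  refine ⟨⟨?_, fun U V hU hUV => hF.1.2.1 _ _ hU (zetaAdjoint_mono hUV), fun U V hU hV => ?_⟩,
    fun S hne hdir hS => ?_⟩
  · exact hF.mem_of_zeta_le hF.1.1 (by rw [zeta_zetaAdjoint]; exact le_top)
  · refine hF.mem_of_zeta_le (hF.1.2.2 _ _ hU hV) ?_
    rw [zeta_inf, zeta_zetaAdjoint, zeta_zetaAdjoint, zeta_zetaAdjoint]
  · have hdir' : DirectedOn (· ≤ ·) (zetaAdjoint '' S) :=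
      hdir.mono_comp fun _ _ h => zetaAdjoint_mono h
    have hmem : sSup (zetaAdjoint '' S) ∈ F := by
      refine hF.mem_of_zeta_le hS ?_
      rw [zeta_zetaAdjoint, zeta_sSup, Set.image_image]
      simp only [zeta_zetaAdjoint, Set.image_id', le_refl]
    obtain ⟨_, ⟨U, hU, rfl⟩, hUF⟩ := hF.2 _ (hne.image _) hdir' hmem
    exact ⟨U, hU, hUF⟩

theorem ScottOpenFrameFilter.zetaAdjoint_zeta_mem_iff {F : Set L} (hF : ScottOpenFrameFilter F)
    {a : L} : zetaAdjoint (zeta a) ∈ F ↔ a ∈ F :=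
  ⟨fun h => hF.mem_of_zeta_le h (zeta_zetaAdjoint _).le,
    fun h => hF.mem_of_zeta_le h (zeta_zetaAdjoint _).ge⟩

end PointSpace

/-- For a frame `L`, the map `H ↦ ζ⁻¹[H]` is an order-isomorphism from the poset of
Scott-open filters of `Ω(pt L)` onto the poset of Scott-open filters of `L`. -/
theorem scottOpenFilters_of_ptOpens_orderIso (L : Type*) [Order.Frame L] :
    ∃ e : {H : Set (TopologicalSpace.Opens (PtSpace L)) // ScottOpenFrameFilter H} ≃o
        {F : Set L // ScottOpenFrameFilter F},
      ∀ H : {H : Set (TopologicalSpace.Opens (PtSpace L)) // ScottOpenFrameFilter H},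
        (e H).1 = {a : L | zeta a ∈ H.1} := by
  refine ⟨{ toFun := fun H => ⟨zeta ⁻¹' H.1, H.2.preimage_zeta⟩
            invFun := fun F => ⟨zetaAdjoint ⁻¹' F.1, F.2.preimage_zetaAdjoint⟩
            left_inv := fun H => ?_
            right_inv := fun F => ?_
            map_rel_iff' := zeta_surjective.preimage_subset_preimage_iff }, fun H => rfl⟩
  · ext U
    simp only [Set.mem_preimage, zeta_zetaAdjoint]
  · ext a
    exact F.2.zetaAdjoint_zeta_mem_iff
end

section
/- (Hofmann–Mislove for sober spaces) For every sober topological space X, the poset of Scott-open filters of the frame Ω(X) of open sets of X, ordered by inclusion, is isomorphic to the poset of compact saturated subsets of X ordered by reverse inclusion ⊇. -/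
open TopologicalSpace in
/-- The intersection of a family of open sets. -/
def opensInter {X : Type*} [TopologicalSpace X] (F : Set (Opens X)) : Set X :=
  {x | ∀ U ∈ F, x ∈ U}

open TopologicalSpace in
/-- The family of open neighbourhoods of a set. -/
def opensContaining {X : Type*} [TopologicalSpace X] (K : Set X) : Set (Opens X) :=
  {U | K ⊆ U}

open TopologicalSpace in
theorem isSaturatedSet_opensInter {X : Type*} [TopologicalSpace X] (F : Set (Opens X)) :
    IsSaturatedSet (opensInter F) := by
  refine ⟨(fun U : Opens X => (U : Set X)) '' F, ?_, ?_⟩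
  · rintro _ ⟨U, -, rfl⟩
    exact U.isOpen
  · ext x
    simp [opensInter]

open TopologicalSpace in
theorem IsSaturatedSet.opensInter_opensContaining {X : Type*} [TopologicalSpace X] {K : Set X}
    (hK : IsSaturatedSet K) : opensInter (opensContaining K) = K := by
  obtain ⟨𝒰, h𝒰, rfl⟩ := hK
  refine Set.Subset.antisymm (fun x hx u hu => ?_) fun x hx U hU => hU hx
  exact hx ⟨u, h𝒰 u hu⟩ (Set.sInter_subset_of_mem hu)

open TopologicalSpace in
theorem IsCompact.scottOpenFrameFilter_opensContaining {X : Type*} [TopologicalSpace X]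
    {K : Set X} (hK : IsCompact K) : ScottOpenFrameFilter (opensContaining K) := by
  refine ⟨⟨Set.subset_univ K, fun a b (ha : K ⊆ a) hab => ha.trans hab,
    fun a b ha hb => Set.subset_inter ha hb⟩, fun S hne hS hK' => ?_⟩
  have : Nonempty S := hne.to_subtype
  obtain ⟨s, hs⟩ := hK.elim_directed_cover (fun s : S => (s.1 : Set X)) (fun s => s.1.isOpen)
    (fun x hx => by simpa using hK' hx) hS.directed_val
  exact ⟨s.1, s.2, hs⟩

/-- An element outside a Scott-open filter lies below a maximal such element. -/
theorem ScottOpenFrameFilter.exists_maximal_notMem {L : Type*} [Order.Frame L] {F : Set L}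
    (hF : ScottOpenFrameFilter F) {a : L} (ha : a ∉ F) :
    ∃ m, a ≤ m ∧ Maximal (fun b => b ∉ F) m := by
  refine zorn_le_nonempty₀ {b | b ∉ F} (fun c hc hchain y hy => ⟨sSup c, fun hmem => ?_,
    fun z hz => le_sSup hz⟩) a ha
  obtain ⟨s, hs, hsF⟩ := hF.2 c ⟨y, hy⟩ hchain.directedOn hmem
  exact hc hs hsF

open TopologicalSpace in
theorem FrameFilter.isIrreducible_compl_of_maximal {X : Type*} [TopologicalSpace X]
    {F : Set (Opens X)} (hF : FrameFilter F) {V : Opens X}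
    (hV : Maximal (fun U => U ∉ F) V) : IsIrreducible ((V : Set X)ᶜ) := by
  have key : ∀ A : Opens X, ((V : Set X)ᶜ ∩ A).Nonempty → V ⊔ A ∈ F := by
    rintro A ⟨x, hxV, hxA⟩
    by_contra h
    exact hxV (hV.2 h le_sup_left (Or.inr hxA : x ∈ (V : Set X) ∪ A))
  refine ⟨?_, fun A B hA hB hVA hVB => ?_⟩
  · by_contra h
    rw [Set.not_nonempty_iff_eq_empty, Set.compl_empty_iff] at h
    exact hV.1 (hF.2.1 ⊤ V hF.1 (fun x _ => (h.symm.subset (Set.mem_univ x) : x ∈ (V : Set X))))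
  · by_contra h
    have hmem := hF.2.2 _ _ (key ⟨A, hA⟩ hVA) (key ⟨B, hB⟩ hVB)
    rw [← sup_inf_left] at hmem
    refine hV.1 (hF.2.1 _ _ hmem (sup_le le_rfl fun x hx => ?_))
    by_contra hxV
    exact h ⟨x, hxV, hx⟩

open TopologicalSpace in
theorem ScottOpenFrameFilter.opensContaining_opensInter {X : Type*} [TopologicalSpace X]
    [QuasiSober X] {F : Set (Opens X)} (hF : ScottOpenFrameFilter F) :
    opensContaining (opensInter F) = F := by
  refine Set.Subset.antisymm (fun U hU => ?_) fun U hU x hx => hx U hU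
  by_contra hUF
  obtain ⟨V, hUV, hV⟩ := hF.exists_maximal_notMem hUF
  obtain ⟨x, hx⟩ := QuasiSober.sober (hF.1.isIrreducible_compl_of_maximal hV)
    V.isOpen.isClosed_compl
  refine hx.mem (hUV (hU fun W hW => ?_))
  by_contra hxW
  have hd := (hx.disjoint_iff W.isOpen).2 hxW
  exact hV.1 (hF.1.2.1 W V hW (Set.disjoint_compl_left_iff_subset.1 hd))

theorem ScottOpenFrameFilter.exists_finset_iSup_mem {L : Type*} [Order.Frame L] {F : Set L}
    (hF : ScottOpenFrameFilter F) {ι : Type*} {U : ι → L} (hU : ⨆ i, U i ∈ F) :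
    ∃ t : Finset ι, ⨆ i ∈ t, U i ∈ F := by
  have hmono : Monotone fun t : Finset ι => ⨆ i ∈ t, U i :=
    fun s t hst => biSup_mono fun i hi => hst hi
  rw [iSup_eq_iSup_finset] at hU
  obtain ⟨_, ⟨t, rfl⟩, ht⟩ := hF.2 _ (Set.range_nonempty _)
    (directedOn_range.2 hmono.directed_le) hU
  exact ⟨t, ht⟩

open TopologicalSpace in
theorem ScottOpenFrameFilter.isCompact_opensInter {X : Type*} [TopologicalSpace X]
    [QuasiSober X] {F : Set (Opens X)} (hF : ScottOpenFrameFilter F) :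
    IsCompact (opensInter F) := by
  refine isCompact_of_finite_subcover fun {ι} U hU hcover => ?_
  let W : ι → Opens X := fun i => ⟨U i, hU i⟩
  have hmem : ⨆ i, W i ∈ F := by
    rw [← hF.opensContaining_opensInter]
    intro x hx
    obtain ⟨i, hi⟩ := Set.mem_iUnion.1 (hcover hx)
    exact Opens.mem_iSup.2 ⟨i, hi⟩
  obtain ⟨t, ht⟩ := hF.exists_finset_iSup_mem hmem
  refine ⟨t, fun x hx => ?_⟩
  have hxt : x ∈ ⨆ i ∈ t, W i := hx _ ht
  simpa [W, Opens.mem_iSup] using hxt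

/-- Hofmann–Mislove for sober spaces: the poset of Scott-open filters of `Ω(X)`
(ordered by `⊆`) is isomorphic to the poset of compact saturated subsets of `X`
ordered by `⊇`. -/
theorem hofmann_mislove_sober_spaces (X : Type*) [TopologicalSpace X]
    [T0Space X] [QuasiSober X] :
    Nonempty ({F : Set (TopologicalSpace.Opens X) // ScottOpenFrameFilter F} ≃o
      ({K : Set X // IsCompact K ∧ IsSaturatedSet K})ᵒᵈ) := by
  refine ⟨{
    toFun := fun F => OrderDual.toDual
      ⟨opensInter F.1, F.2.isCompact_opensInter, isSaturatedSet_opensInter F.1⟩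
    invFun := fun K => ⟨opensContaining (OrderDual.ofDual K).1,
      (OrderDual.ofDual K).2.1.scottOpenFrameFilter_opensContaining⟩
    left_inv := fun F => Subtype.ext F.2.opensContaining_opensInter
    right_inv := fun K => Subtype.ext (OrderDual.ofDual K).2.2.opensInter_opensContaining
    map_rel_iff' := ?_ }⟩
  intro F G
  change opensInter G.1 ⊆ opensInter F.1 ↔ F.1 ⊆ G.1
  refine ⟨fun h U hU => ?_, fun h x hx U hU => hx U (h hU)⟩
  rw [← G.2.opensContaining_opensInter]
  exact fun x hx => h hx U hU
end

section
/- Let M be a locally compact MT-algebra and a, b ∈ O(M). Then a ◁ b if and only if a ≪ b in the frame O(M). -/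
namespace MTAlg

variable {M : Type*} [CompleteBooleanAlgebra M] {T : MTAlg M}

theorem IsCompactElem.bot : T.IsCompactElem ⊥ :=
  fun _ _ _ => ⟨∅, Set.empty_subset _, Set.finite_empty, bot_le⟩

theorem IsCompactElem.sup {k l : M} (hk : T.IsCompactElem k) (hl : T.IsCompactElem l) :
    T.IsCompactElem (k ⊔ l) := by
  intro S hS h
  obtain ⟨t, htS, ht, hkt⟩ := hk S hS (le_sup_left.trans h)
  obtain ⟨t', htS', ht', hlt⟩ := hl S hS (le_sup_right.trans h)
  refine ⟨t ∪ t', Set.union_subset htS htS', ht.union ht', ?_⟩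
  rw [sSup_union]
  exact sup_le_sup hkt hlt

theorem triangle_sSup_of_finite {t : Set M} (ht : t.Finite) {b : M}
    (h : ∀ v ∈ t, T.Triangle v b) : T.Triangle (sSup t) b := by
  induction t, ht using Set.Finite.induction_on with
  | empty => exact ⟨⊥, .bot, by simp, bot_le⟩
  | @insert v t _ _ ih =>
    obtain ⟨k, hk, hvk, hkb⟩ := h v (Set.mem_insert v t)
    obtain ⟨l, hl, htl, hlb⟩ := ih fun w hw => h w (Set.mem_insert_of_mem v hw)
    refine ⟨k ⊔ l, hk.sup hl, ?_, sup_le hkb hlb⟩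
    rw [sSup_insert]
    exact sup_le_sup hvk htl

theorem Triangle.wayBelowOpen {a b : M} (h : T.Triangle a b) : T.WayBelowOpen a b := by
  obtain ⟨k, hk, hak, hkb⟩ := h
  intro S hS hbS
  obtain ⟨t, htS, ht, hkt⟩ := hk S hS (hkb.trans hbS)
  exact ⟨t, htS, ht, hak.trans hkt⟩

theorem LocallyCompact.triangle_of_wayBelowOpen (hlc : T.LocallyCompact) {a b : M}
    (hb : T.IsOpenElem b) (h : T.WayBelowOpen a b) : T.Triangle a b := by
  obtain ⟨t, htS, ht, hat⟩ := h _ (fun _ hs => hs.1) (hlc b hb).le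
  obtain ⟨k, hk, htk, hkb⟩ := triangle_sSup_of_finite ht fun v hv => (htS hv).2
  exact ⟨k, hk, hat.trans htk, hkb⟩

end MTAlg

/-- In a locally compact MT-algebra, `a ◁ b` iff `a ≪ b` in the frame of opens. -/
theorem triangle_iff_wayBelow {M : Type*} [CompleteBooleanAlgebra M] (T : MTAlg M)
    (hlc : T.LocallyCompact) (a b : M) (ha : T.IsOpenElem a) (hb : T.IsOpenElem b) :
    T.Triangle a b ↔ T.WayBelowOpen a b := by
  exact ⟨MTAlg.Triangle.wayBelowOpen, hlc.triangle_of_wayBelowOpen hb⟩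
end
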